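/- arXiv:2103.13695 — 3 statements merged into one kernel-verified Lean document; each statement's English description precedes it below -/
import Mathlib

section
/- Let n ≥ 2 and 1 ≤ i ≤ n−1. Then the operators σ_i on C^n(k_αG,M) satisfy the braid relation: σ_i(σ_{i+1}(σ_i(φ))) = σ_{i+1}(σ_i(σ_{i+1}(φ))) for every φ ∈ C^n(k_αG,M). -/
/- Common setup: twisted group algebras modelled on their canonical basis.
An element of the twisted group algebra `k_αG` is modelled as a function `G → k`
(its coordinates in the basis `{ḡ : g ∈ G}`), and a Hochschild `n`-cochain
`Hom_k((k_αG)^{⊗n}, M)` is modelled by its values on basis tensors, i.e. as a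
function `(Fin n → G) → M`.  Similarly a group cochain `C^n(H, A)` is a function
`(Fin n → H) → A`; the one-dimensional module `k x̄` is modelled as `k` with the
action of `h` given by multiplication by the character `χ(h) = α(h,x)·α(x,h)⁻¹`. -/

namespace TwistedSym

section Defs

variable {k : Type*} [CommRing k] {G : Type*} [Group G] [DecidableEq G]
variable {M : Type*} [AddCommGroup M] [Module k M]
variable {H : Type*} [Group H]
variable {A : Type*} [AddCommGroup A] [DistribMulAction H A]

/-- The 2-cocycle condition `α(x,yz)α(y,z) = α(xy,z)α(x,y)`. -/
def IsCocycle (α : G → G → kˣ) : Prop :=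
  ∀ x y z : G, α x (y * z) * α y z = α (x * y) z * α x y

/-- Normalization `α(1,x) = α(x,1) = 1`. -/
def IsNormalized (α : G → G → kˣ) : Prop :=
  ∀ x : G, α 1 x = 1 ∧ α x 1 = 1

/-- `(L, R)` encode a `(k_αG, k_αG)`-bimodule structure on the `k`-module `M`:
`L g` is left multiplication by the basis element `ḡ` and `R g` is right
multiplication by `ḡ`. -/
def IsBimodule (α : G → G → kˣ) (L R : G → M →ₗ[k] M) : Prop :=
  (∀ m : M, L 1 m = m) ∧ (∀ m : M, R 1 m = m) ∧
  (∀ (g h : G) (m : M), L g (L h m) = (α g h : k) • L (g * h) m) ∧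
  (∀ (g h : G) (m : M), R h (R g m) = (α g h : k) • R (g * h) m) ∧
  (∀ (g h : G) (m : M), L g (R h m) = R h (L g m))

/-- The tuple of group elements appearing in the action of the transposition
`σ_{i0+1} = (i0+1, i0+2)` on `n`-cochains (0-indexed `i0 : Fin n`):
position `i0 - 1` gets `g_{i0-1}·g_{i0}`, position `i0` gets `g_{i0}⁻¹` and
position `i0 + 1` gets `g_{i0}·g_{i0+1}` (when these positions exist). -/
def swapTuple {n : ℕ} (i0 : Fin n) (g : Fin n → H) : Fin n → H := fun j =>
  if (j : ℕ) + 1 = (i0 : ℕ) then g j * g i0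
  else if j = i0 then (g i0)⁻¹
  else if (j : ℕ) = (i0 : ℕ) + 1 then g i0 * g j
  else g j

/-- The action of the transposition `σ_{i0+1} = (i0+1,i0+2) ∈ Σ_{n+1}` on Hochschild
`n`-cochains of the twisted group algebra `k_αG` with coefficients in the bimodule `M`.
All the `α`-scalars come from rewriting products and inverses of basis elements in
terms of basis elements: `ḡ·h̄ = α(g,h)·(gh)‾` and `ḡ⁻¹ = α(g,g⁻¹)⁻¹·(g⁻¹)‾`. -/
def hSigma (α : G → G → kˣ) (L R : G → M →ₗ[k] M) {n : ℕ} (i0 : Fin n)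
    (φ : (Fin n → G) → M) : (Fin n → G) → M := fun g =>
  -(((if 0 < (i0 : ℕ) then
        (α (g ⟨(i0 : ℕ) - 1, lt_of_le_of_lt (Nat.sub_le _ _) i0.isLt⟩) (g i0) : k) else 1) *
     (((α (g i0) (g i0)⁻¹)⁻¹ : kˣ) : k) *
     (if h : (i0 : ℕ) + 1 < n then (α (g i0) (g ⟨(i0 : ℕ) + 1, h⟩) : k) else 1)) •
    (if (i0 : ℕ) = 0 then
        L (g i0) (if (i0 : ℕ) + 1 = n then R (g i0) (φ (swapTuple i0 g)) else φ (swapTuple i0 g))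
      else (if (i0 : ℕ) + 1 = n then R (g i0) (φ (swapTuple i0 g)) else φ (swapTuple i0 g))))

/-- Staic's action of the transposition `σ_{i0+1} ∈ Σ_{n+1}` on group `n`-cochains
with values in an `H`-module `A`. -/
def gSigma {n : ℕ} (i0 : Fin n) (ψ : (Fin n → H) → A) : (Fin n → H) → A := fun h =>
  -(if (i0 : ℕ) = 0 then h i0 • ψ (swapTuple i0 h) else ψ (swapTuple i0 h))

/-- Staic's action of the transposition `σ_{i0+1} ∈ Σ_{n+1}` on group `n`-cochains
with values in the rank-one module `k` on which `H` acts through the character `χ`. -/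
def cSigma (χ : H → k) {n : ℕ} (i0 : Fin n) (ψ : (Fin n → H) → k) : (Fin n → H) → k := fun h =>
  -(if (i0 : ℕ) = 0 then χ (h i0) * ψ (swapTuple i0 h) else ψ (swapTuple i0 h))

/-- The `(n+1)`-tuple `g` with entries at positions `j, j+1` multiplied together. -/
def mergeAt {n : ℕ} (g : Fin (n + 1) → H) (j : Fin n) : Fin n → H := fun l =>
  if (l : ℕ) < (j : ℕ) then g (Fin.castSucc l)
  else if l = j then g (Fin.castSucc l) * g (Fin.succ l)
  else g (Fin.succ l)

/-- The Hochschild differential `δ^n` for the twisted group algebra `k_αG` with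
coefficients in the bimodule `M`, written on basis tensors (the scalar
`α(g_j, g_{j+1})` comes from `ḡ_j·ḡ_{j+1} = α(g_j,g_{j+1})·(g_jg_{j+1})‾`). -/
def hDiff (α : G → G → kˣ) (L R : G → M →ₗ[k] M) {n : ℕ}
    (φ : (Fin n → G) → M) : (Fin (n + 1) → G) → M := fun g =>
  L (g 0) (φ fun j => g j.succ)
    + ∑ j : Fin n, ((-1 : ℤ) ^ ((j : ℕ) + 1)) •
        ((α (g j.castSucc) (g j.succ) : k) • φ (mergeAt g j))
    + ((-1 : ℤ) ^ (n + 1)) • R (g (Fin.last n)) (φ fun j => g j.castSucc)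

/-- The group cohomology differential `∂^n` for cochains on `H` with values in the
`H`-module `A`. -/
def gDiff {n : ℕ} (ψ : (Fin n → H) → A) : (Fin (n + 1) → H) → A := fun h =>
  h 0 • ψ (fun j => h j.succ)
    + ∑ j : Fin n, ((-1 : ℤ) ^ ((j : ℕ) + 1)) • ψ (mergeAt h j)
    + ((-1 : ℤ) ^ (n + 1)) • ψ (fun j => h j.castSucc)

/-- The group cohomology differential `∂^n` for cochains on `H` with values in the
rank-one module `k` on which `H` acts through the character `χ`. -/
def cDiff (χ : H → k) {n : ℕ} (ψ : (Fin n → H) → k) : (Fin (n + 1) → H) → k := fun h =>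
  χ (h 0) * ψ (fun j => h j.succ)
    + ∑ j : Fin n, ((-1 : ℤ) ^ ((j : ℕ) + 1)) • ψ (mergeAt h j)
    + ((-1 : ℤ) ^ (n + 1)) • ψ (fun j => h j.castSucc)

/-- Left multiplication by the basis element `ḡ` on `k_αG` (modelled as `G → k`). -/
def Lmul (α : G → G → kˣ) (g : G) : (G → k) →ₗ[k] (G → k) where
  toFun a := fun y => (α g (g⁻¹ * y) : k) * a (g⁻¹ * y)
  map_add' a b := by funext y; simp [mul_add]
  map_smul' c a := by funext y; simp [smul_eq_mul]; ring

/-- Right multiplication by the basis element `ḡ` on `k_αG` (modelled as `G → k`). -/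
def Rmul (α : G → G → kˣ) (g : G) : (G → k) →ₗ[k] (G → k) where
  toFun a := fun y => (α (y * g⁻¹) g : k) * a (y * g⁻¹)
  map_add' a b := by funext y; simp [mul_add]
  map_smul' c a := by funext y; simp [smul_eq_mul]; ring

/-- Iterated right multiplication: `rmuls α [g₁,…,gₙ] v = v·ḡ₁·…·ḡₙ`. -/
def rmuls (α : G → G → kˣ) (l : List G) (v : G → k) : G → k :=
  l.foldl (fun w g => Rmul α g w) v

/-- Iterated right multiplication by inverses of basis elements:
`rinvs α [h₁,…,hₙ] v = v·h̄ₙ⁻¹·…·h̄₁⁻¹`, using `h̄⁻¹ = α(h,h⁻¹)⁻¹·(h⁻¹)‾`. -/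
def rinvs (α : G → G → kˣ) (l : List G) (v : G → k) : G → k :=
  l.foldr (fun h w => (((α h h⁻¹)⁻¹ : kˣ) : k) • Rmul α h⁻¹ w) v

/-- The character through which `h ∈ C_G(x)` acts on the module `k x̄`:
`χ(h) = α(h,x)·α(x,h)⁻¹`. -/
def chi (α : G → G → kˣ) (x : G) : G → k := fun h =>
  (α h x : k) * (((α x h)⁻¹ : kˣ) : k)

/-- The map `π^n_{G,x,α} : C^n(k_αG, k_αG) → C^n(C_G(x), k x̄)`: the value on
`(h₁,…,hₙ)` is the coefficient of the basis element `x̄` in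
`φ(h̄₁⊗…⊗h̄ₙ)·h̄ₙ⁻¹·…·h̄₁⁻¹` (identifying `k x̄` with `k`). -/
def piC (α : G → G → kˣ) (x : G) {n : ℕ} (φ : (Fin n → G) → (G → k)) :
    (Fin n → Subgroup.centralizer ({x} : Set G)) → k := fun h =>
  rinvs α (List.ofFn fun i => (h i : G)) (φ fun i => (h i : G)) x

/-- The same map as `piC` for a central element `x`, in which case `C_G(x) = G`:
`π^n_{G,x,α} : C^n(k_αG, k_αG) → C^n(G, k x̄)`. -/
def piZ (α : G → G → kˣ) (x : G) {n : ℕ} (φ : (Fin n → G) → (G → k)) :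
    (Fin n → G) → k := fun h =>
  rinvs α (List.ofFn h) (φ h) x

/-- The map `ν^n_{G,x,α} : C^n(G, k x̄) → C^n(k_αG, k_αG)` for `x ∈ Z(G)`:
`ψ ↦ (ḡ₁⊗…⊗ḡₙ ↦ ψ(g₁,…,gₙ)·x̄·ḡ₁·…·ḡₙ)` (identifying `k x̄` with `k`). -/
def nuZ (α : G → G → kˣ) (x : G) {n : ℕ} (ψ : (Fin n → G) → k) :
    (Fin n → G) → (G → k) := fun g =>
  ψ g • rmuls α (List.ofFn g) (Pi.single x 1)

/-- Iteration of the index map of a coset decomposition along a list of group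
elements: `chainIdx idx j [g₁,…,gᵢ]` is the index `s_j^i`. -/
def chainIdx {m : ℕ} (idx : Fin m → G → Fin m) (j : Fin m) : List G → Fin m
  | [] => j
  | a :: l => chainIdx idx (idx j a) l

/-- The map `ν^n_{G,x} : C^n(C_G(x), kx) → C^n(kG, kG)` for the (untwisted) group
algebra, relative to a right coset decomposition `G = ⋃ⱼ C_G(x)γⱼ`:
`ν(ψ)(g₁⊗…⊗gₙ) = Σⱼ ψ(h_{j,1},…,h_{j,n})·x⁻¹·xⱼ·g₁⋯gₙ` where
`xⱼ = γⱼ⁻¹xγⱼ`, the `h_{j,i} = rep (s_j^{i-1}) gᵢ ∈ C_G(x)` are determined by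
`γ_{s_j^{i-1}}·gᵢ = h_{j,i}·γ_{s_j^i}` and `kx` is identified with `k`. -/
def nuT (x : G) {m n : ℕ} (γ : Fin m → G) (idx : Fin m → G → Fin m)
    (rep : Fin m → G → G)
    (hrep : ∀ j a, rep j a ∈ Subgroup.centralizer ({x} : Set G))
    (ψ : (Fin n → Subgroup.centralizer ({x} : Set G)) → k) :
    (Fin n → G) → (G → k) := fun g =>
  ∑ j : Fin m,
    ψ (fun i => ⟨rep (chainIdx idx j ((List.ofFn g).take (i : ℕ))) (g i), hrep _ _⟩) •
      (Pi.single ((γ j)⁻¹ * x * γ j * (List.ofFn g).prod) (1 : k) : G → k)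

/-- `φ` is a Hochschild coboundary (for `n = 0` the coboundary space is `0`). -/
def IsHCoboundary (α : G → G → kˣ) (L R : G → M →ₗ[k] M) :
    ∀ {n : ℕ}, ((Fin n → G) → M) → Prop
  | 0, φ => φ = 0
  | _ + 1, φ => ∃ θ, φ = hDiff α L R θ

/-- `φ` is the Hochschild coboundary of a `Σ`-invariant cochain. -/
def IsHSCoboundary (α : G → G → kˣ) (L R : G → M →ₗ[k] M) :
    ∀ {n : ℕ}, ((Fin n → G) → M) → Prop
  | 0, φ => φ = 0
  | _ + 1, φ => ∃ θ, (∀ i0, hSigma α L R i0 θ = θ) ∧ φ = hDiff α L R θ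

/-- `ψ` is a group-cohomology coboundary (coefficients in `k` through `χ`). -/
def IsCCoboundary (χ : H → k) : ∀ {n : ℕ}, ((Fin n → H) → k) → Prop
  | 0, ψ => ψ = 0
  | _ + 1, ψ => ∃ θ, ψ = cDiff χ θ

/-- `ψ` is the coboundary of a `Σ`-invariant group cochain (coefficients through `χ`). -/
def IsCSCoboundary (χ : H → k) : ∀ {n : ℕ}, ((Fin n → H) → k) → Prop
  | 0, ψ => ψ = 0
  | _ + 1, ψ => ∃ θ, (∀ i0, cSigma χ i0 θ = θ) ∧ ψ = cDiff χ θ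

/-- `ψ` is a group-cohomology coboundary (coefficients in the `H`-module `A`). -/
def IsGCoboundary : ∀ {n : ℕ}, ((Fin n → H) → A) → Prop
  | 0, ψ => ψ = 0
  | _ + 1, ψ => ∃ θ, ψ = gDiff θ

/-- `ψ` is the coboundary of a `Σ`-invariant group cochain (coefficients in `A`). -/
def IsGSCoboundary : ∀ {n : ℕ}, ((Fin n → H) → A) → Prop
  | 0, ψ => ψ = 0
  | _ + 1, ψ => ∃ θ, (∀ i0, gSigma i0 θ = θ) ∧ ψ = gDiff θ

end Defs

section Cocycle

variable {k : Type*} [CommRing k] {G : Type*} [Group G] {α : G → G → kˣ}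

lemma IsCocycle.inv_comm (hα : IsCocycle α) (hnorm : IsNormalized α) (x : G) :
    α x⁻¹ x = α x x⁻¹ := by
  simpa [(hnorm x).1, (hnorm x).2] using hα x x⁻¹ x

lemma IsCocycle.inv_mul_mul_inv (hα : IsCocycle α) (hnorm : IsNormalized α) (b c : G) :
    α b⁻¹ (b * c) * α c (c⁻¹ * b⁻¹) = α (b * c) c⁻¹ * α (c⁻¹ * b⁻¹) b := by
  have h₁ := hα b⁻¹ b c
  have h₂ := hα b c c⁻¹
  have h₃ := hα b c (c⁻¹ * b⁻¹)
  have h₄ := hα (c⁻¹ * b⁻¹) b c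
  have h₅ := hα.inv_comm hnorm (b * c)
  simp only [inv_mul_cancel, mul_inv_cancel, mul_inv_cancel_left, inv_mul_cancel_right,
    mul_inv_rev, (hnorm _).1, (hnorm _).2, one_mul, hα.inv_comm hnorm b,
    hα.inv_comm hnorm c] at h₁ h₂ h₃ h₄ h₅
  rw [h₅] at h₄
  have hl : α b⁻¹ (b * c) * α c (c⁻¹ * b⁻¹) = α (b * c) (c⁻¹ * b⁻¹) := by
    rw [eq_div_of_mul_eq' h₁, div_mul_eq_mul_div, h₃, mul_div_cancel_right]
  have hr : α (b * c) c⁻¹ * α (c⁻¹ * b⁻¹) b = α (b * c) (c⁻¹ * b⁻¹) := by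
    rw [eq_div_of_mul_eq' h₂.symm, div_mul_eq_mul_div, ← h₄, mul_div_cancel_right]
  rw [hl, hr]

end Cocycle

lemma swapTuple_braid {H : Type*} [Group H] {n : ℕ} (i : Fin n) (hi : (i : ℕ) + 1 < n)
    (g : Fin n → H) :
    swapTuple i (swapTuple ⟨(i : ℕ) + 1, hi⟩ (swapTuple i g)) =
      swapTuple ⟨(i : ℕ) + 1, hi⟩ (swapTuple i (swapTuple ⟨(i : ℕ) + 1, hi⟩ g)) := by
  have e₂ (a : ℕ) : a + 1 + 1 ≠ a := by omega
  have e₃ (a : ℕ) : a + 1 + 1 + 1 ≠ a := by omega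
  funext j
  rcases i with ⟨i, h⟩
  rcases j with ⟨j, hj⟩
  simp only [swapTuple, Fin.mk.injEq]
  by_cases h₁ : j + 1 = i
  · subst h₁; simp [mul_assoc, e₂, (e₂ _).symm, (e₃ _).symm]
  by_cases h₂ : j = i
  · subst h₂; simp [e₂]
  by_cases h₃ : j = i + 1
  · subst h₃; simp [e₂]
  by_cases h₄ : j = i + 1 + 1
  · subst h₄; simp [mul_assoc, e₂, e₃]
  simp [h₁, h₂, h₃, h₄]

/-- the operators `σ_i` on `C^n(k_αG, M)` satisfy the braid relation
`σ_i σ_{i+1} σ_i = σ_{i+1} σ_i σ_{i+1}` for `1 ≤ i ≤ n-1`. -/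
theorem sigma_braid
    {k : Type*} [Field k] {G : Type*} [Group G] [Fintype G] [DecidableEq G]
    {M : Type*} [AddCommGroup M] [Module k M]
    (α : G → G → kˣ) (hα : IsCocycle α) (hnorm : IsNormalized α)
    (L R : G → M →ₗ[k] M) (hbim : IsBimodule α L R)
    {n : ℕ} (hn : 2 ≤ n) (i0 : Fin n) (hi : (i0 : ℕ) + 1 < n)
    (φ : (Fin n → G) → M) :
    hSigma α L R i0 (hSigma α L R ⟨(i0 : ℕ) + 1, hi⟩ (hSigma α L R i0 φ)) =
      hSigma α L R ⟨(i0 : ℕ) + 1, hi⟩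
        (hSigma α L R i0 (hSigma α L R ⟨(i0 : ℕ) + 1, hi⟩ φ)) := by
  have e₂ (a : ℕ) : a + 1 + 1 ≠ a := by omega
  have e₃ (a : ℕ) : a + 1 + 1 + 1 ≠ a := by omega
  funext g
  obtain ⟨-, -, hL, hR, hLR⟩ := hbim
  simp only [hSigma]
  rw [← swapTuple_braid i0 hi g]
  generalize φ (swapTuple i0 (swapTuple ⟨(i0 : ℕ) + 1, hi⟩ (swapTuple i0 g))) = m
  obtain ⟨i, h⟩ := i0
  change i + 1 < n at hi
  have hmid := congrArg Units.val (hα.inv_mul_mul_inv hnorm (g ⟨i, h⟩) (g ⟨i + 1, hi⟩))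
  have hright (hd : i + 1 + 1 < n) :=
    congrArg Units.val (hα (g ⟨i, h⟩) (g ⟨i + 1, hi⟩) (g ⟨i + 1 + 1, hd⟩))
  simp only [Units.val_mul] at hmid hright
  rcases i with _ | i
  · simp only [zero_add] at hi
    by_cases hn' : 1 + 1 < n
    · have := hright hn'
      simp [swapTuple, hi, hi.ne, hn', hn'.ne, hL, smul_smul] at this hmid ⊢
      congr 1
      grind only
    · obtain rfl : 1 + 1 = n := by omega
      simp [swapTuple, hL, hR, ← hLR, smul_smul] at hmid ⊢
      congr 1
      grind only
  · have hleft := congrArg Units.val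
      (hα (g ⟨i, by omega⟩) (g ⟨i + 1, h⟩) (g ⟨i + 1 + 1, hi⟩))
    simp only [Units.val_mul] at hleft
    by_cases hn' : i + 1 + 1 + 1 < n
    · have := hright hn'
      simp [swapTuple, hi, hi.ne, hn', hn'.ne, e₂, e₃, (e₂ _).symm, (e₃ _).symm,
        smul_smul] at hmid hleft this ⊢
      congr 1
      grind only
    · obtain rfl : i + 1 + 1 + 1 = n := by omega
      simp [swapTuple, e₂, (e₂ _).symm, (e₃ _).symm, hR, smul_smul] at hmid hleft ⊢
      congr 1
      grind only

end TwistedSym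
end

section
/- Let n ≥ 1 and let φ ∈ C^n(k_αG,M) satisfy σ_i(φ) = φ for all i ∈ {1,…,n} (i.e. φ is Σ_{n+1}-invariant). Then δ^n(φ) ∈ C^{n+1}(k_αG,M) satisfies σ_i(δ^n(φ)) = δ^n(φ) for all i ∈ {1,…,n+1} (i.e. δ^n(φ) is Σ_{n+2}-invariant). Hence the invariants CS^n(k_αG,M) = (C^n(k_αG,M))^{Σ_{n+1}} form a subcomplex of the Hochschild cochain complex, whose cohomology defines the symmetric Hochschild cohomology HHS^n(k_αG,M). -/
/- Common setup: twisted group algebras modelled on their canonical basis.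
An element of the twisted group algebra `k_αG` is modelled as a function `G → k`
(its coordinates in the basis `{ḡ : g ∈ G}`), and a Hochschild `n`-cochain
`Hom_k((k_αG)^{⊗n}, M)` is modelled by its values on basis tensors, i.e. as a
function `(Fin n → G) → M`.  Similarly a group cochain `C^n(H, A)` is a function
`(Fin n → H) → A`; the one-dimensional module `k x̄` is modelled as `k` with the
action of `h` given by multiplication by the character `χ(h) = α(h,x)·α(x,h)⁻¹`. -/

namespace TwistedSym

section Homogeneous

variable {E : Type*} [Group E]

/-- The successive quotients `x_i⁻¹·x_{i+1}` of a tuple. -/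
def quotients {n : ℕ} (x : Fin (n + 1) → E) : Fin n → E :=
  fun i => (x i.castSucc)⁻¹ * x i.succ

theorem swapTuple_quotients {n : ℕ} (i : Fin n) (x : Fin (n + 1) → E) :
    swapTuple i (quotients x) = quotients (x ∘ Equiv.swap i.castSucc i.succ) := by
  funext j
  rcases lt_trichotomy ((j : ℕ) + 1) i with h | h | h
  · simp only [swapTuple, quotients, Function.comp, Equiv.swap_apply_def, Fin.ext_iff,
      Fin.val_castSucc, Fin.val_succ]
    split_ifs <;> first | omega | rfl
  · have e : j.succ = i.castSucc := Fin.ext h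
    simp only [swapTuple, quotients, Function.comp, Equiv.swap_apply_def, e, h, Fin.ext_iff,
      Fin.val_castSucc, Fin.val_succ]
    split_ifs <;> first | omega | group
  · rcases eq_or_ne (j : ℕ) i with h' | h'
    · obtain rfl : j = i := Fin.ext h'
      simp [swapTuple, quotients]
    · rcases eq_or_ne (j : ℕ) (i + 1) with h'' | h''
      · have e : j.castSucc = i.succ := Fin.ext h''
        simp only [swapTuple, quotients, Function.comp, Equiv.swap_apply_def, e, Fin.ext_iff,
          Fin.val_castSucc, Fin.val_succ]
        split_ifs <;> first | omega | group
      · simp only [swapTuple, quotients, Function.comp, Equiv.swap_apply_def, Fin.ext_iff,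
          Fin.val_castSucc, Fin.val_succ]
        split_ifs <;> first | omega | rfl

theorem mergeAt_quotients {n : ℕ} (j : Fin n) (x : Fin (n + 2) → E) :
    mergeAt (quotients x) j = quotients (x ∘ j.succ.castSucc.succAbove) := by
  funext l
  rcases lt_trichotomy (l : ℕ) j with h | h | h
  · have h1 : j.succ.castSucc.succAbove l.castSucc = l.castSucc.castSucc :=
      Fin.succAbove_of_castSucc_lt _ _ (Fin.lt_def.2 (by simp; omega))
    have h2 : j.succ.castSucc.succAbove l.succ = l.castSucc.succ :=
      Fin.succAbove_of_castSucc_lt _ _ (Fin.lt_def.2 (by simp; omega))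
    simp only [mergeAt, quotients, Function.comp, h, h1, h2, if_true, Fin.succ_castSucc]
  · obtain rfl : l = j := Fin.ext h
    have h1 : l.succ.castSucc.succAbove l.castSucc = l.castSucc.castSucc :=
      Fin.succAbove_of_castSucc_lt _ _ (Fin.lt_def.2 (by simp))
    have h2 : l.succ.castSucc.succAbove l.succ = l.succ.succ :=
      Fin.succAbove_of_le_castSucc _ _ (by simp)
    simp only [mergeAt, quotients, Function.comp, h1, h2, lt_irrefl, if_false, if_true,
      Fin.succ_castSucc]
    group
  · have h1 : j.succ.castSucc.succAbove l.castSucc = l.succ.castSucc :=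
      Fin.succAbove_of_le_castSucc _ _ (Fin.le_def.2 (by simp; omega))
    have h2 : j.succ.castSucc.succAbove l.succ = l.succ.succ :=
      Fin.succAbove_of_le_castSucc _ _ (Fin.le_def.2 (by simp; omega))
    simp only [mergeAt, quotients, Function.comp, h1, h2, h.not_gt, Fin.ext_iff, h.ne', if_false]

theorem quotients_partialProd {n : ℕ} (g : Fin n → E) : quotients (Fin.partialProd g) = g :=
  funext fun i => Fin.partialProd_right_inv g i

theorem swap_comp_succAbove_castSucc {n : ℕ} (i : Fin (n + 1)) :
    Equiv.swap i.castSucc i.succ ∘ i.castSucc.succAbove = i.succ.succAbove := by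
  funext l
  simp only [Function.comp, Fin.succAbove, Equiv.swap_apply_def, Fin.lt_def, Fin.ext_iff,
    Fin.val_castSucc, Fin.val_succ]
  split_ifs <;> simp_all <;> omega

theorem swap_comp_succAbove_succ {n : ℕ} (i : Fin (n + 1)) :
    Equiv.swap i.castSucc i.succ ∘ i.succ.succAbove = i.castSucc.succAbove := by
  rw [← swap_comp_succAbove_castSucc]
  funext l
  simp

theorem exists_swap_comp_succAbove {n : ℕ} (i : Fin (n + 1)) (j : Fin (n + 2))
    (h₁ : j ≠ i.castSucc) (h₂ : j ≠ i.succ) :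
    ∃ i' : Fin n, Equiv.swap i.castSucc i.succ ∘ j.succAbove =
      j.succAbove ∘ Equiv.swap i'.castSucc i'.succ := by
  rw [Ne, Fin.ext_iff] at h₁ h₂
  simp only [Fin.val_castSucc, Fin.val_succ] at h₁ h₂
  rcases lt_or_gt_of_ne h₁ with h | h
  · refine ⟨⟨i - 1, by omega⟩, funext fun l => ?_⟩
    simp only [Function.comp, Fin.succAbove, Equiv.swap_apply_def, Fin.lt_def, Fin.ext_iff,
      Fin.val_castSucc, Fin.val_succ]
    split_ifs <;> simp_all <;> omega
  · refine ⟨⟨i, by omega⟩, funext fun l => ?_⟩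
    simp only [Function.comp, Fin.succAbove, Equiv.swap_apply_def, Fin.lt_def, Fin.ext_iff,
      Fin.val_castSucc, Fin.val_succ]
    split_ifs <;> simp_all <;> omega

/-- The alternating sum of faces of an adjacent-swap-alternating function is again
adjacent-swap-alternating. -/
theorem alternating_sum_faces {X M : Type*} [AddCommGroup M] {n : ℕ}
    (F : (Fin (n + 1) → X) → M)
    (hF : ∀ (i : Fin n) x, F (x ∘ Equiv.swap i.castSucc i.succ) = -F x)
    (i : Fin (n + 1)) (x : Fin (n + 2) → X) :
    ∑ j : Fin (n + 2), ((-1 : ℤ) ^ (j : ℕ)) •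
        F ((x ∘ Equiv.swap i.castSucc i.succ) ∘ j.succAbove) =
      -∑ j : Fin (n + 2), ((-1 : ℤ) ^ (j : ℕ)) • F (x ∘ j.succAbove) := by
  rw [← Equiv.sum_comp (Equiv.swap i.castSucc i.succ)
    (fun j : Fin (n + 2) => ((-1 : ℤ) ^ (j : ℕ)) • F (x ∘ j.succAbove)),
    ← Finset.sum_neg_distrib]
  refine Finset.sum_congr rfl fun j _ => ?_
  rw [Function.comp_assoc]
  by_cases h₁ : j = i.castSucc
  · subst h₁
    rw [swap_comp_succAbove_castSucc, Equiv.swap_apply_left]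
    simp [pow_succ]
  by_cases h₂ : j = i.succ
  · subst h₂
    rw [swap_comp_succAbove_succ, Equiv.swap_apply_right]
    simp [pow_succ]
  obtain ⟨i', hi'⟩ := exists_swap_comp_succAbove i j h₁ h₂
  rw [hi', ← Function.comp_assoc, hF, Equiv.swap_apply_of_ne_of_ne h₁ h₂, smul_neg]

end Homogeneous

section Untwisted

variable {k : Type*} [CommRing k] {E : Type*} [Group E]
variable {M : Type*} [AddCommGroup M] [Module k M]

/-- The homogeneous form `x ↦ x_0·Φ(x_0⁻¹x_1, …, x_{n-1}⁻¹x_n)·x_n⁻¹` of a cochain. -/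
def homogenize (L R : E → M →ₗ[k] M) {n : ℕ} (Φ : (Fin n → E) → M) :
    (Fin (n + 1) → E) → M :=
  fun x => L (x 0) (R (x (Fin.last n))⁻¹ (Φ (quotients x)))

variable {L R : E → M →ₗ[k] M}

theorem homogenize_injective (hbim : IsBimodule (1 : E → E → kˣ) L R) {n : ℕ} :
    Function.Injective (homogenize L R : ((Fin n → E) → M) → _) := by
  obtain ⟨hL1, hR1, -, hR, -⟩ := hbim
  intro Φ Ψ h
  funext g
  have key := congrArg (R (Fin.partialProd g (Fin.last n))) (congrFun h (Fin.partialProd g))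
  simpa [homogenize, hL1, quotients_partialProd, hR, hR1] using key

theorem homogenize_hSigma (hbim : IsBimodule (1 : E → E → kˣ) L R) {n : ℕ} (i : Fin n)
    (Φ : (Fin n → E) → M) (x : Fin (n + 1) → E) :
    homogenize L R (hSigma 1 L R i Φ) x =
      -homogenize L R Φ (x ∘ Equiv.swap i.castSucc i.succ) := by
  obtain ⟨-, -, hL, hR, hLR⟩ := hbim
  have hl : ∀ m, L (x 0) (if (i : ℕ) = 0 then L (quotients x i) m else m) =
      L (x (Equiv.swap i.castSucc i.succ 0)) m := by
    intro m
    split_ifs with h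
    · have e : i.castSucc = 0 := Fin.ext h
      simp [quotients, hL, e]
    · rw [Equiv.swap_apply_of_ne_of_ne (by simp [Fin.ext_iff]; omega) (by simp [Fin.ext_iff])]
  have hr : ∀ m, R (x (Fin.last n))⁻¹ (if (i : ℕ) + 1 = n then R (quotients x i) m else m) =
      R (x (Equiv.swap i.castSucc i.succ (Fin.last n)))⁻¹ m := by
    intro m
    split_ifs with h
    · have e : i.succ = Fin.last n := Fin.ext h
      simp [quotients, hR, ← e]
    · rw [Equiv.swap_apply_of_ne_of_ne] <;> simp [Fin.ext_iff] <;> omega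
  simp only [homogenize, hSigma, swapTuple_quotients, Function.comp, ← hl, ← hr]
  split_ifs <;> simp [hLR]

theorem homogenize_hDiff (hbim : IsBimodule (1 : E → E → kˣ) L R) {n : ℕ}
    (Φ : (Fin n → E) → M) (x : Fin (n + 2) → E) :
    homogenize L R (hDiff 1 L R Φ) x =
      ∑ j : Fin (n + 2), ((-1 : ℤ) ^ (j : ℕ)) • homogenize L R Φ (x ∘ j.succAbove) := by
  obtain ⟨-, -, hL, hR, hLR⟩ := hbim
  rw [Fin.sum_univ_succ, Fin.sum_univ_castSucc]
  have hfirst : L (x 0) (R (x (Fin.last (n + 1)))⁻¹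
      (L (quotients x 0) (Φ fun j => quotients x j.succ))) =
        homogenize L R Φ (x ∘ Fin.succ) := by
    rw [← hLR, hL]
    simp [homogenize, quotients]
    rfl
  have hlast : L (x 0) (R (x (Fin.last (n + 1)))⁻¹
      (R (quotients x (Fin.last n)) (Φ fun j => quotients x j.castSucc))) =
        homogenize L R Φ (x ∘ Fin.castSucc) := by
    rw [hR]
    simp [homogenize, quotients]
    rfl
  have hmid : ∀ j : Fin n, L (x 0) (R (x (Fin.last (n + 1)))⁻¹ (Φ (mergeAt (quotients x) j))) =
      homogenize L R Φ (x ∘ j.castSucc.succ.succAbove) := by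
    intro j
    rw [mergeAt_quotients, homogenize, Fin.succ_castSucc]
    congr
    exact (Fin.succAbove_ne_last_last (Fin.castSucc_ne_last _)).symm
  conv_lhs => simp only [homogenize, hDiff, map_add, map_sum, map_zsmul]
  simp only [hfirst, hlast, hmid, Pi.one_apply, Units.val_one, one_smul]
  simp [add_assoc]

theorem hSigma_hDiff_of_untwisted (hbim : IsBimodule (1 : E → E → kˣ) L R) {n : ℕ}
    (Φ : (Fin n → E) → M) (hΦ : ∀ i : Fin n, hSigma 1 L R i Φ = Φ) (i : Fin (n + 1)) :
    hSigma 1 L R i (hDiff 1 L R Φ) = hDiff 1 L R Φ := by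
  refine homogenize_injective hbim (funext fun x => ?_)
  rw [homogenize_hSigma hbim, homogenize_hDiff hbim, homogenize_hDiff hbim,
    alternating_sum_faces _ _ i x, neg_neg]
  intro i x
  rw [← neg_eq_iff_eq_neg, ← homogenize_hSigma hbim, hΦ]

end Untwisted

section Extension

variable {k : Type*} [CommRing k] {G : Type*} [Group G]

/-- The central extension of `G` by `kˣ` defined by the normalized cocycle `α`. -/
@[ext]
structure Extension (α : G → G → kˣ) (hα : IsCocycle α) (hnorm : IsNormalized α) where
  /-- The coefficient of a homogeneous unit of the twisted group algebra. -/
  scalar : kˣ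
  /-- The group element underlying a homogeneous unit of the twisted group algebra. -/
  base : G

namespace Extension

variable {α : G → G → kˣ} {hα : IsCocycle α} {hnorm : IsNormalized α}

instance : Mul (Extension α hα hnorm) :=
  ⟨fun x y => ⟨x.scalar * y.scalar * α x.base y.base, x.base * y.base⟩⟩

instance : One (Extension α hα hnorm) := ⟨⟨1, 1⟩⟩

instance : Inv (Extension α hα hnorm) :=
  ⟨fun x => ⟨x.scalar⁻¹ * (α x.base x.base⁻¹)⁻¹, x.base⁻¹⟩⟩

@[simp] theorem scalar_mul (x y : Extension α hα hnorm) :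
    (x * y).scalar = x.scalar * y.scalar * α x.base y.base := rfl

@[simp] theorem base_mul (x y : Extension α hα hnorm) : (x * y).base = x.base * y.base := rfl

@[simp] theorem scalar_one : (1 : Extension α hα hnorm).scalar = 1 := rfl

@[simp] theorem base_one : (1 : Extension α hα hnorm).base = 1 := rfl

@[simp] theorem scalar_inv (x : Extension α hα hnorm) :
    x⁻¹.scalar = x.scalar⁻¹ * (α x.base x.base⁻¹)⁻¹ := rfl

@[simp] theorem base_inv (x : Extension α hα hnorm) : x⁻¹.base = x.base⁻¹ := rfl

instance : Group (Extension α hα hnorm) :=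
  Group.ofLeftAxioms
    (fun x y z => by
      ext1
      · have h := hα x.base y.base z.base
        simp only [scalar_mul, base_mul]
        calc _ = x.scalar * y.scalar * z.scalar *
              (α (x.base * y.base) z.base * α x.base y.base) := by ac_rfl
          _ = _ := by rw [← h]; ac_rfl
      · exact mul_assoc _ _ _)
    (fun x => by ext1 <;> simp [(hnorm _).1])
    (fun x => by
      have h := hα x.base x.base⁻¹ x.base
      simp only [inv_mul_cancel, mul_inv_cancel, (hnorm _).1, (hnorm _).2, one_mul] at h
      ext1 <;> simp [h])

variable {M : Type*} [AddCommGroup M] [Module k M]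

/-- The action of the extension by a family of operators indexed by the base group. -/
def act (L : G → M →ₗ[k] M) (x : Extension α hα hnorm) : M →ₗ[k] M :=
  (x.scalar : k) • L x.base

theorem isBimodule_act {L R : G → M →ₗ[k] M}
    (hbim : IsBimodule α L R) :
    IsBimodule (1 : Extension α hα hnorm → Extension α hα hnorm → kˣ) (act L) (act R) := by
  obtain ⟨hL1, hR1, hL, hR, hLR⟩ := hbim
  refine ⟨fun m => by simp [act, hL1], fun m => by simp [act, hR1], fun x y m => ?_,
    fun x y m => ?_, fun x y m => ?_⟩
  · simp [act, hL, smul_smul, mul_comm, mul_left_comm]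
  · simp only [act, LinearMap.smul_apply, map_smul, hR, smul_smul, scalar_mul, base_mul,
      Units.val_mul, Pi.one_apply, Units.val_one, one_mul]
    congr 1
    ring
  · simp only [act, LinearMap.smul_apply, map_smul, hLR, smul_smul]
    rw [mul_comm]

/-- The multilinear extension of a cochain to tuples of homogeneous units. -/
def lift {n : ℕ} (φ : (Fin n → G) → M) : (Fin n → Extension α hα hnorm) → M :=
  fun g => ((∏ j, (g j).scalar : kˣ) : k) • φ fun j => (g j).base

theorem lift_injective {n : ℕ} :
    Function.Injective
      (lift : ((Fin n → G) → M) → (Fin n → Extension α hα hnorm) → M) := by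
  intro φ ψ h
  funext g
  simpa [lift] using congrFun h fun j => ⟨1, g j⟩

theorem base_mergeAt {n : ℕ} (g : Fin (n + 1) → Extension α hα hnorm) (j : Fin n) :
    (fun l => (mergeAt g j l).base) = mergeAt (fun l => (g l).base) j := by
  funext l
  simp only [mergeAt]
  split_ifs <;> rfl

theorem prod_scalar_mergeAt {n : ℕ} (g : Fin (n + 1) → Extension α hα hnorm) (j : Fin n) :
    ∏ l, (mergeAt g j l).scalar =
      (∏ l, (g l).scalar) * α (g j.castSucc).base (g j.succ).base := by
  have h : ∀ l, (mergeAt g j l).scalar = (g (j.castSucc.succAbove l)).scalar *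
      if l = j then (g j.castSucc).scalar * α (g j.castSucc).base (g j.succ).base else 1 := by
    intro l
    rcases lt_trichotomy l j with h | rfl | h
    · rw [Fin.succAbove_of_castSucc_lt _ _ (by simpa using h)]
      simp [mergeAt, h, h.ne]
    · simp [mergeAt]
      ac_rfl
    · rw [Fin.succAbove_of_le_castSucc _ _ (by simpa using h.le)]
      simp [mergeAt, h.not_gt, h.ne']
  rw [Fintype.prod_congr _ _ h, Finset.prod_mul_distrib, Fin.prod_univ_succAbove _ j.castSucc]
  simp
  ac_rfl

theorem base_swapTuple {n : ℕ} (i : Fin n) (g : Fin n → Extension α hα hnorm) :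
    (fun l => (swapTuple i g l).base) = swapTuple i fun l => (g l).base := by
  funext l
  simp only [swapTuple]
  split_ifs <;> rfl

theorem prod_scalar_swapTuple {n : ℕ} (i : Fin n) (g : Fin n → Extension α hα hnorm) :
    (if (i : ℕ) = 0 then (g i).scalar else 1) * (if (i : ℕ) + 1 = n then (g i).scalar else 1) *
      ∏ l, (swapTuple i g l).scalar =
    (∏ l, (g l).scalar) *
      ((if 0 < (i : ℕ) then
        α (g ⟨(i : ℕ) - 1, lt_of_le_of_lt (Nat.sub_le _ _) i.isLt⟩).base (g i).base else 1) *
      (α (g i).base (g i).base⁻¹)⁻¹ *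
      (if h : (i : ℕ) + 1 < n then α (g i).base (g ⟨(i : ℕ) + 1, h⟩).base else 1)) := by
  have h : ∀ l, (swapTuple i g l).scalar = (g l).scalar *
      (if (l : ℕ) + 1 = i then (g i).scalar * α (g l).base (g i).base else 1) *
      (if l = i then ((g i).scalar * (g i).scalar)⁻¹ * (α (g i).base (g i).base⁻¹)⁻¹ else 1) *
      (if (l : ℕ) = i + 1 then (g i).scalar * α (g i).base (g l).base else 1) := by
    intro l
    simp only [swapTuple]
    split_ifs <;> first | (simp_all; done) | (simp_all; omega) | (simp_all; ac_rfl) |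
      (simp_all [mul_assoc])
  have h₁ : ∏ l : Fin n, (if (l : ℕ) + 1 = i then (g i).scalar * α (g l).base (g i).base else 1) =
      if 0 < (i : ℕ) then (g i).scalar *
        α (g ⟨(i : ℕ) - 1, lt_of_le_of_lt (Nat.sub_le _ _) i.isLt⟩).base (g i).base else 1 := by
    split_ifs with hi
    · rw [Fintype.prod_eq_single ⟨(i : ℕ) - 1, lt_of_le_of_lt (Nat.sub_le _ _) i.isLt⟩]
      · rw [if_pos (by simp; omega)]
      · intro l hl
        rw [if_neg]
        rw [Ne, Fin.ext_iff] at hl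
        simp only at hl
        omega
    · exact Finset.prod_eq_one fun l _ => if_neg (by omega)
  have h₂ : ∏ l : Fin n, (if (l : ℕ) = i + 1 then (g i).scalar * α (g i).base (g l).base else 1) =
      if h : (i : ℕ) + 1 < n then (g i).scalar * α (g i).base (g ⟨(i : ℕ) + 1, h⟩).base
        else 1 := by
    split_ifs with hi
    · rw [Fintype.prod_eq_single ⟨(i : ℕ) + 1, hi⟩]
      · rw [if_pos rfl]
      · intro l hl
        rw [if_neg]
        rwa [Ne, Fin.ext_iff] at hl
    · exact Finset.prod_eq_one fun l _ => if_neg (by omega)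
  rw [Fintype.prod_congr _ _ h]
  simp only [Finset.prod_mul_distrib, h₁, h₂, Finset.prod_ite_eq', Finset.mem_univ, if_true]
  generalize (g i).scalar = s
  generalize ∏ l, (g l).scalar = p
  refine Eq.trans ?_ (mul_inv_cancel_left (s * s) _)
  generalize (s * s)⁻¹ = t
  split_ifs <;> first | omega | ac_rfl

theorem lift_hDiff (L R : G → M →ₗ[k] M) {n : ℕ} (φ : (Fin n → G) → M) :
    (lift (hDiff α L R φ) : (Fin (n + 1) → Extension α hα hnorm) → M) =
      hDiff 1 (act L) (act R) (lift φ) := by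
  funext g
  simp only [lift, hDiff, act, prod_scalar_mergeAt, base_mergeAt, smul_add, Finset.smul_sum]
  congr 1
  · congr 1
    · simp [Fin.prod_univ_succ, smul_smul, mul_comm]
    · refine Finset.sum_congr rfl fun j _ => ?_
      rw [smul_comm]
      simp [smul_smul]
  · rw [smul_comm, Fin.prod_univ_castSucc]
    simp [smul_smul, mul_comm]

theorem lift_hSigma (L R : G → M →ₗ[k] M) {n : ℕ} (i : Fin n) (φ : (Fin n → G) → M) :
    (lift (hSigma α L R i φ) : (Fin n → Extension α hα hnorm) → M) =
      hSigma 1 (act L) (act R) i (lift φ) := by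
  funext g
  have h := congrArg (Units.val) (prod_scalar_swapTuple i g)
  have hfun : ∀ m : M, (if (i : ℕ) = 0 then
      act L (g i) (if (i : ℕ) + 1 = n then act R (g i) m else m)
      else (if (i : ℕ) + 1 = n then act R (g i) m else m)) =
      (((if (i : ℕ) = 0 then (g i).scalar else 1) *
        (if (i : ℕ) + 1 = n then (g i).scalar else 1) : kˣ) : k) •
      (if (i : ℕ) = 0 then
        L (g i).base (if (i : ℕ) + 1 = n then R (g i).base m else m)
      else (if (i : ℕ) + 1 = n then R (g i).base m else m)) := by
    intro m
    split_ifs <;> simp [act, smul_smul]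
  have hsmul : ∀ (c : k) (m : M), (if (i : ℕ) = 0 then
        L (g i).base (if (i : ℕ) + 1 = n then R (g i).base (c • m) else c • m)
      else (if (i : ℕ) + 1 = n then R (g i).base (c • m) else c • m)) =
      c • (if (i : ℕ) = 0 then
        L (g i).base (if (i : ℕ) + 1 = n then R (g i).base m else m)
      else (if (i : ℕ) + 1 = n then R (g i).base m else m)) := by
    intro c m
    split_ifs <;> simp
  simp only [lift, hSigma, hfun, hsmul, base_swapTuple, smul_neg, smul_smul, Pi.one_apply]
  congr 2
  rw [← Units.val_mul, h]
  split_ifs <;> simp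

end Extension

end Extension

/-- the `Σ`-action is compatible with the Hochschild differential: if
`φ ∈ C^n(k_αG,M)` is `Σ_{n+1}`-invariant then `δ^n(φ)` is `Σ_{n+2}`-invariant.
Hence the invariants `CS^*(k_αG,M)` form a subcomplex, whose cohomology defines
the symmetric Hochschild cohomology `HHS^*(k_αG,M)`. -/
theorem sigma_compatible_with_differential
    {k : Type*} [Field k] {G : Type*} [Group G] [Fintype G] [DecidableEq G]
    {M : Type*} [AddCommGroup M] [Module k M]
    (α : G → G → kˣ) (hα : IsCocycle α) (hnorm : IsNormalized α)
    (L R : G → M →ₗ[k] M) (hbim : IsBimodule α L R)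
    {n : ℕ} (φ : (Fin n → G) → M)
    (hφ : ∀ i0 : Fin n, hSigma α L R i0 φ = φ) :
    ∀ i0 : Fin (n + 1), hSigma α L R i0 (hDiff α L R φ) = hDiff α L R φ := by
  have hlift : ∀ i : Fin n, hSigma 1 (Extension.act L) (Extension.act R) i
      (Extension.lift (hα := hα) (hnorm := hnorm) φ) = Extension.lift φ := fun i => by
    rw [← Extension.lift_hSigma, hφ]
  intro i
  apply Extension.lift_injective (hα := hα) (hnorm := hnorm)
  rw [Extension.lift_hSigma, Extension.lift_hDiff]
  exact hSigma_hDiff_of_untwisted (Extension.isBimodule_act hbim) _ hlift i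

end TwistedSym
end

section
/- Let n ≥ 1 and x ∈ Z(G). Then δ^{n−1} ∘ ν^{n−1}_{G,x,α} = ν^n_{G,x,α} ∘ ∂^{n−1} as maps C^{n−1}(G, k x̄) → C^n(k_αG,k_αG); that is, the maps ν^*_{G,x,α} commute with the group-cohomology differential ∂^* and the Hochschild differential δ^*. -/
/- Common setup: twisted group algebras modelled on their canonical basis.
An element of the twisted group algebra `k_αG` is modelled as a function `G → k`
(its coordinates in the basis `{ḡ : g ∈ G}`), and a Hochschild `n`-cochain
`Hom_k((k_αG)^{⊗n}, M)` is modelled by its values on basis tensors, i.e. as a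
function `(Fin n → G) → M`.  Similarly a group cochain `C^n(H, A)` is a function
`(Fin n → H) → A`; the one-dimensional module `k x̄` is modelled as `k` with the
action of `h` given by multiplication by the character `χ(h) = α(h,x)·α(x,h)⁻¹`. -/

namespace TwistedSym

/-- Right multiplication by `ḡ` followed by `h̄` is `α(g,h)` times right multiplication
by `(gh)‾`. -/
theorem Rmul_Rmul {k : Type*} [CommRing k] {G : Type*} [Group G]
    {α : G → G → kˣ} (hα : IsCocycle α) (g h : G) (a : G → k) :
    Rmul α h (Rmul α g a) = (α g h : k) • Rmul α (g * h) a := by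
  funext y
  have e := congrArg (Units.val) (hα (y * h⁻¹ * g⁻¹) g h)
  simp only [Units.val_mul, inv_mul_cancel_right] at e
  simp only [Rmul, LinearMap.coe_mk, AddHom.coe_mk, Pi.smul_apply, smul_eq_mul, mul_inv_rev,
    ← mul_assoc y]
  linear_combination -(a (y * h⁻¹ * g⁻¹)) * e

/-- Left and right multiplications by basis elements commute. -/
theorem Lmul_Rmul {k : Type*} [CommRing k] {G : Type*} [Group G]
    {α : G → G → kˣ} (hα : IsCocycle α) (g h : G) (a : G → k) :
    Lmul α g (Rmul α h a) = Rmul α h (Lmul α g a) := by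
  funext y
  have e := congrArg (Units.val) (hα g (g⁻¹ * y * h⁻¹) h)
  simp only [Units.val_mul, inv_mul_cancel_right, ← mul_assoc, mul_inv_cancel, one_mul] at e
  simp only [Lmul, Rmul, LinearMap.coe_mk, AddHom.coe_mk, ← mul_assoc]
  linear_combination (a (g⁻¹ * y * h⁻¹)) * e

/-- For central `x`, `ḡ·x̄ = χ(g)·x̄·ḡ`. -/
theorem Lmul_single {k : Type*} [CommRing k] {G : Type*} [Group G] [DecidableEq G]
    (α : G → G → kˣ) {x : G} (hx : x ∈ Subgroup.center G) (g : G) :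
    Lmul α g (Pi.single x (1 : k)) = chi α x g • Rmul α g (Pi.single x 1) := by
  have hgx : g * x = x * g := Subgroup.mem_center_iff.mp hx g
  funext y
  simp only [Lmul, Rmul, chi, LinearMap.coe_mk, AddHom.coe_mk, Pi.smul_apply, smul_eq_mul]
  by_cases hy : y = x * g
  · subst hy
    have h1 : g⁻¹ * (x * g) = x := by rw [← hgx, inv_mul_cancel_left]
    simp [h1]
  · have h1 : g⁻¹ * y ≠ x := fun h => hy (by rw [← hgx, ← h, mul_inv_cancel_left])
    have h2 : y * g⁻¹ ≠ x := fun h => hy (by rw [← h, inv_mul_cancel_right])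
    simp [h1, h2]

theorem rmuls_smul {k : Type*} [CommRing k] {G : Type*} [Group G]
    (α : G → G → kˣ) (l : List G) (c : k) (v : G → k) :
    rmuls α l (c • v) = c • rmuls α l v := by
  induction l generalizing v with
  | nil => rfl
  | cons g l ih =>
    simp only [rmuls, List.foldl_cons, map_smul] at ih ⊢
    exact ih _

theorem Lmul_rmuls {k : Type*} [CommRing k] {G : Type*} [Group G]
    {α : G → G → kˣ} (hα : IsCocycle α) (g : G) (l : List G) (v : G → k) :
    Lmul α g (rmuls α l v) = rmuls α l (Lmul α g v) := by
  induction l generalizing v with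
  | nil => rfl
  | cons h l ih =>
    simp only [rmuls, List.foldl_cons] at ih ⊢
    rw [ih, Lmul_Rmul hα]

theorem mergeAt_zero {H : Type*} [Group H] {n : ℕ} (g : Fin (n + 2) → H) :
    mergeAt g 0 = Fin.cons (g 0 * g 1) fun i => g i.succ.succ := by
  funext l
  refine Fin.cases ?_ (fun i => ?_) l
  · simp [mergeAt]
  · simp [mergeAt, Fin.succ_ne_zero]

theorem mergeAt_succ {H : Type*} [Group H] {n : ℕ} (g : Fin (n + 2) → H) (j : Fin n) :
    mergeAt g j.succ = Fin.cons (g 0) (mergeAt (fun i => g i.succ) j) := by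
  funext l
  refine Fin.cases ?_ (fun i => ?_) l
  · simp [mergeAt]
  · simp [mergeAt]

/-- Multiplying two adjacent entries of a tuple changes the iterated right multiplication
by the corresponding cocycle value. -/
theorem smul_rmuls_mergeAt {k : Type*} [CommRing k] {G : Type*} [Group G]
    {α : G → G → kˣ} (hα : IsCocycle α) {n : ℕ} (g : Fin (n + 1) → G) (j : Fin n)
    (v : G → k) :
    (α (g j.castSucc) (g j.succ) : k) • rmuls α (List.ofFn (mergeAt g j)) v =
      rmuls α (List.ofFn g) v := by
  induction n generalizing v with
  | zero => exact j.elim0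
  | succ n ih =>
    refine Fin.cases ?_ (fun i => ?_) j
    · rw [mergeAt_zero, ← rmuls_smul]
      simp only [List.ofFn_succ, Fin.cons_zero, Fin.cons_succ, rmuls, List.foldl_cons,
        map_smul, Rmul_Rmul hα]
      rfl
    · have := ih (fun i => g i.succ) i (Rmul α (g 0) v)
      rw [mergeAt_succ, List.ofFn_succ (f := g), List.ofFn_succ]
      simp only [Fin.cons_zero, Fin.cons_succ, rmuls, List.foldl_cons] at this ⊢
      exact this

/-- for central `x` the maps `ν^*_{G,x,α}` commute with the
group-cohomology differential `∂^*` of `C^*(G, k x̄)` and the Hochschild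
differential `δ^*`. -/
theorem nuZ_comm_diff
    {k : Type*} [Field k] {G : Type*} [Group G] [Fintype G] [DecidableEq G]
    (α : G → G → kˣ) (hα : IsCocycle α) (hnorm : IsNormalized α)
    (x : G) (hx : x ∈ Subgroup.center G)
    {n : ℕ} (ψ : (Fin n → G) → k) :
    nuZ α x (cDiff (chi α x) ψ) = hDiff α (Lmul α) (Rmul α) (nuZ α x ψ) := by
  funext g
  simp only [nuZ, cDiff, hDiff, map_smul, add_smul, Finset.sum_smul]
  have hfirst : Lmul α (g 0) (rmuls α (List.ofFn fun j => g j.succ) (Pi.single x 1)) =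
      chi α x (g 0) • rmuls α (List.ofFn g) (Pi.single x (1 : k)) := by
    rw [Lmul_rmuls hα, Lmul_single α hx, rmuls_smul, List.ofFn_succ (f := g)]
    rfl
  have hlast : Rmul α (g (Fin.last n))
      (rmuls α (List.ofFn fun j => g j.castSucc) (Pi.single x 1)) =
      rmuls α (List.ofFn g) (Pi.single x (1 : k)) := by
    rw [List.ofFn_succ' (f := g), List.concat_eq_append]
    simp [rmuls, List.foldl_append]
  rw [hfirst, hlast]
  congr 1
  · congr 1
    · rw [smul_smul, mul_comm]
    · refine Finset.sum_congr rfl fun j _ => ?_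
      rw [smul_assoc, ← smul_rmuls_mergeAt hα g j, smul_comm (ψ (mergeAt g j))]
  · rw [smul_assoc]

end TwistedSym
end
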